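/- For every regular infinite-tree expression E ∈ RegExp^∞(F,K), every Markov-algebra interpretation (M, ⟦·⟧), and every hole-valuation γ : K → M, the algebraic interpretation of E coincides with the tree interpretation of its hyper-path: M_γ⟦E⟧ = r^M_γ(𝓣_K⟦E⟧). -/

import Mathlib

abbrev Pos := List ℕ

inductive Label (F : Type) (K : Type) where
  | sym (f : F)
  | var (k : K)
  | loop

def Label.arity {F K : Type} (ar : F → ℕ) : Label F K → ℕ
  | .sym f => ar f
  | .var _ => 0
  | .loop => 0

/-- A possibly-infinite tree, as a partial map from positions to labels. -/
abbrev PTree (F K : Type) := Pos → Option (Label F K)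

def IsTree {F K : Type} (ar : F → ℕ) (t : PTree F K) : Prop :=
  t [] ≠ none ∧
  (∀ (p : Pos) (j : ℕ), t (p ++ [j]) ≠ none → t p ≠ none) ∧
  (∀ (p : Pos) (l : Label F K), t p = some l →
    ∀ j : ℕ, (t (p ++ [j]) ≠ none ↔ 1 ≤ j ∧ j ≤ Label.arity ar l))

def subtree {F K : Type} (t : PTree F K) (p : Pos) : PTree F K := fun q => t (p ++ q)

def loopTree {F K : Type} : PTree F K := fun p => if p = [] then some Label.loop else none

/-- A relation `R` is compatible with the coinductive characterization of refinement. -/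
def RefineCompat {F K : Type} (ar : F → ℕ) (R : PTree F K → PTree F K → Prop) : Prop :=
  ∀ t₁ t₂, R t₁ t₂ →
    t₁ = loopTree ∨
    ∃ l : Label F K, l ≠ Label.loop ∧ t₁ [] = some l ∧ t₂ [] = some l ∧
      ∀ i : ℕ, 1 ≤ i → i ≤ Label.arity ar l → R (subtree t₁ [i]) (subtree t₂ [i])

/-- The refinement relation `⊑_T`: the largest relation compatible with the
coinductive characterization. -/
def Refine {F K : Type} (ar : F → ℕ) (t₁ t₂ : PTree F K) : Prop :=
  ∃ R, RefineCompat ar R ∧ R t₁ t₂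

/-- `s` is the supremum (w.r.t. `⊑_T`) of the ω-chain `c` of possibly-infinite trees. -/
def IsSupTree {F K : Type} (ar : F → ℕ) (c : ℕ → PTree F K) (s : PTree F K) : Prop :=
  (∀ i, Refine ar (c i) s) ∧ ∀ u, IsTree ar u → (∀ i, Refine ar (c i) u) → Refine ar s u

/- Substitution of the tree `u` for every occurrence of the hole variable `z` in `t`
(the coinductively defined substitution operator, given pointwise). -/
open Classical in
noncomputable def subst {F K : Type} (z : K) (t u : PTree F K) : PTree F K := fun p =>
  if h : ∃ q : Pos, q <+: p ∧ t q = some (Label.var z) then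
    u (p.drop h.choose.length)
  else t p

abbrev Prob : Type := Set.Icc (0 : ℝ) 1

/-- The program alphabet: ε, sequencing, conditional-, probabilistic-, and
nondeterministic-choice. -/
inductive PSym (A : Type) (L : Type) where
  | eps
  | seq (act : A)
  | cond (φ : L)
  | prob (p : Prob)
  | ndet

def PSym.arity {A L : Type} : PSym A L → ℕ
  | .eps => 0
  | .seq _ => 1
  | .cond _ => 2
  | .prob _ => 2
  | .ndet => 2

/-- A Markov algebra over logical conditions `L`: a dcpo with least element, a monoid
`⊗`, confluence operations `◃φ▹`, `⋄p`, `⌣` (all Scott-continuous), with `⌣` an upper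
semilattice operation dominating the other two confluences. -/
structure MarkovAlg (L : Type) (M : Type) [PartialOrder M] where
  bot : M
  one : M
  mul : M → M → M
  cond : L → M → M → M
  prob : Prob → M → M → M
  ndet : M → M → M
  bot_le : ∀ a, bot ≤ a
  dcpo : ∀ d : Set M, d.Nonempty → DirectedOn (· ≤ ·) d → ∃ s, IsLUB d s
  mul_assoc : ∀ a b c, mul (mul a b) c = mul a (mul b c)
  one_mul : ∀ a, mul one a = a
  mul_one : ∀ a, mul a one = a
  ndet_idem : ∀ a, ndet a a = a
  ndet_comm : ∀ a b, ndet a b = ndet b a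
  ndet_assoc : ∀ a b c, ndet (ndet a b) c = ndet a (ndet b c)
  cond_le_ndet : ∀ φ a b, ndet (cond φ a b) (ndet a b) = ndet a b
  prob_le_ndet : ∀ p a b, ndet (prob p a b) (ndet a b) = ndet a b
  mul_scott_left : ∀ a, ScottContinuous fun x => mul x a
  mul_scott_right : ∀ a, ScottContinuous (mul a)
  cond_scott_left : ∀ φ a, ScottContinuous fun x => cond φ x a
  cond_scott_right : ∀ φ a, ScottContinuous (cond φ a)
  prob_scott_left : ∀ p a, ScottContinuous fun x => prob p x a
  prob_scott_right : ∀ p a, ScottContinuous (prob p a)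
  ndet_scott_left : ∀ a, ScottContinuous fun x => ndet x a
  ndet_scott_right : ∀ a, ScottContinuous (ndet a)

/-- The approximating sequence of the coinductively defined tree interpretation
`r^M_γ` of possibly-infinite trees over the program alphabet, for the Markov-algebra
interpretation `(P, ia)` and hole-valuation `γ`. -/
def maSeq {A L K M : Type} [PartialOrder M] (P : MarkovAlg L M) (ia : A → M)
    (γ : K → M) : ℕ → PTree (PSym A L) K → M
  | 0, _ => P.bot
  | i + 1, t =>
    match t [] with
    | some (.sym .eps) => P.one
    | some (.sym (.seq act)) => P.mul (ia act) (maSeq P ia γ i (subtree t [1]))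
    | some (.sym (.cond φ)) =>
        P.cond φ (maSeq P ia γ i (subtree t [1])) (maSeq P ia γ i (subtree t [2]))
    | some (.sym (.prob p)) =>
        P.prob p (maSeq P ia γ i (subtree t [1])) (maSeq P ia γ i (subtree t [2]))
    | some (.sym .ndet) =>
        P.ndet (maSeq P ia γ i (subtree t [1])) (maSeq P ia γ i (subtree t [2]))
    | some (.var k) => γ k
    | _ => P.bot

/-- `r` is the coinductively defined Markov-algebra tree interpretation `r^M_γ`,
i.e. the pointwise supremum of the approximating sequence. -/
def IsTreeInterp {A L K M : Type} [PartialOrder M] (P : MarkovAlg L M) (ia : A → M)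
    (γ : K → M) (r : PTree (PSym A L) K → M) : Prop :=
  ∀ t, IsLUB (Set.range fun i => maSeq P ia γ i t) (r t)

/-- Regular infinite-tree expressions over the program alphabet, with concatenation
`E₁ ·_z E₂` and closure `E^{∞_z}`. -/
inductive RegExp (A : Type) (L : Type) (K : Type) where
  | eps
  | var (z : K)
  | seq (act : A) (E : RegExp A L K)
  | cond (φ : L) (E₁ E₂ : RegExp A L K)
  | prob (p : Prob) (E₁ E₂ : RegExp A L K)
  | ndet (E₁ E₂ : RegExp A L K)
  | concat (z : K) (E₁ E₂ : RegExp A L K)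
  | closure (z : K) (E : RegExp A L K)

def leafTree {F K : Type} (l : Label F K) : PTree F K :=
  fun p => if p = [] then some l else none

def node1 {F K : Type} (f : F) (t : PTree F K) : PTree F K := fun p =>
  match p with
  | [] => some (Label.sym f)
  | 1 :: q => t q
  | _ => none

def node2 {F K : Type} (f : F) (t₁ t₂ : PTree F K) : PTree F K := fun p =>
  match p with
  | [] => some (Label.sym f)
  | 1 :: q => t₁ q
  | 2 :: q => t₂ q
  | _ => none

/-- The hyper-path interpretation `𝓣_K⟦E⟧`: `TreeOf E t` states that `t` is the
possibly-infinite tree denoted by the regular infinite-tree expression `E`.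
For closures, `t` is the `⊑_T`-least fixed point of substituting into the body. -/
inductive TreeOf {A L K : Type} : RegExp A L K → PTree (PSym A L) K → Prop where
  | eps : TreeOf RegExp.eps (leafTree (Label.sym PSym.eps))
  | var (z : K) : TreeOf (RegExp.var z) (leafTree (Label.var z))
  | seq (act : A) {E : RegExp A L K} {t : PTree (PSym A L) K} :
      TreeOf E t → TreeOf (RegExp.seq act E) (node1 (PSym.seq act) t)
  | cond (φ : L) {E₁ E₂ : RegExp A L K} {t₁ t₂ : PTree (PSym A L) K} :
      TreeOf E₁ t₁ → TreeOf E₂ t₂ →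
      TreeOf (RegExp.cond φ E₁ E₂) (node2 (PSym.cond φ) t₁ t₂)
  | prob (p : Prob) {E₁ E₂ : RegExp A L K} {t₁ t₂ : PTree (PSym A L) K} :
      TreeOf E₁ t₁ → TreeOf E₂ t₂ →
      TreeOf (RegExp.prob p E₁ E₂) (node2 (PSym.prob p) t₁ t₂)
  | ndet {E₁ E₂ : RegExp A L K} {t₁ t₂ : PTree (PSym A L) K} :
      TreeOf E₁ t₁ → TreeOf E₂ t₂ →
      TreeOf (RegExp.ndet E₁ E₂) (node2 PSym.ndet t₁ t₂)
  | concat (z : K) {E₁ E₂ : RegExp A L K} {t₁ t₂ : PTree (PSym A L) K} :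
      TreeOf E₁ t₁ → TreeOf E₂ t₂ →
      TreeOf (RegExp.concat z E₁ E₂) (subst z t₁ t₂)
  | closure (z : K) {E : RegExp A L K} {t' s : PTree (PSym A L) K} :
      TreeOf E t' → IsTree PSym.arity s →
      subst z t' s = s →
      (∀ u, IsTree PSym.arity u → subst z t' u = u → Refine PSym.arity s u) →
      TreeOf (RegExp.closure z E) s

/-- The algebraic interpretation `M_γ⟦E⟧` of a regular infinite-tree expression in a
Markov algebra; closures are interpreted as least fixed points (starting from `0`). -/
inductive MInterp {A L K M : Type} [PartialOrder M] [DecidableEq K]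
    (P : MarkovAlg L M) (ia : A → M) :
    RegExp A L K → (K → M) → M → Prop where
  | eps (γ : K → M) : MInterp P ia RegExp.eps γ P.one
  | var (γ : K → M) (z : K) : MInterp P ia (RegExp.var z) γ (γ z)
  | seq (act : A) {E : RegExp A L K} {γ : K → M} {v : M} :
      MInterp P ia E γ v → MInterp P ia (RegExp.seq act E) γ (P.mul (ia act) v)
  | cond (φ : L) {E₁ E₂ : RegExp A L K} {γ : K → M} {v₁ v₂ : M} :
      MInterp P ia E₁ γ v₁ → MInterp P ia E₂ γ v₂ →
      MInterp P ia (RegExp.cond φ E₁ E₂) γ (P.cond φ v₁ v₂)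
  | prob (p : Prob) {E₁ E₂ : RegExp A L K} {γ : K → M} {v₁ v₂ : M} :
      MInterp P ia E₁ γ v₁ → MInterp P ia E₂ γ v₂ →
      MInterp P ia (RegExp.prob p E₁ E₂) γ (P.prob p v₁ v₂)
  | ndet {E₁ E₂ : RegExp A L K} {γ : K → M} {v₁ v₂ : M} :
      MInterp P ia E₁ γ v₁ → MInterp P ia E₂ γ v₂ →
      MInterp P ia (RegExp.ndet E₁ E₂) γ (P.ndet v₁ v₂)
  | concat (z : K) {E₁ E₂ : RegExp A L K} {γ : K → M} {v₂ v : M} :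
      MInterp P ia E₂ γ v₂ → MInterp P ia E₁ (Function.update γ z v₂) v →
      MInterp P ia (RegExp.concat z E₁ E₂) γ v
  | closure (z : K) {E : RegExp A L K} {γ : K → M} (g : M → M) {v : M} :
      (∀ θ, MInterp P ia E (Function.update γ z θ) (g θ)) →
      g v = v → (∀ w, g w = w → v ≤ w) →
      MInterp P ia (RegExp.closure z E) γ v

/-- Variables label only leaves. -/
def VarLeaf {F K : Type} (t : PTree F K) : Prop :=
  ∀ (p : Pos) (k : K), t p = some (.var k) → ∀ (j : ℕ) (q : Pos), t (p ++ j :: q) = none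

theorem IsTree.varLeaf {F K : Type} {ar : F → ℕ} {t : PTree F K} (ht : IsTree ar t) :
    VarLeaf t := by
  intro p k hp j q
  induction q using List.reverseRecOn with
  | nil =>
    by_contra h
    have := (ht.2.2 p _ hp j).1 h
    simp only [Label.arity] at this
    omega
  | append_singleton q i ih =>
    by_contra h
    exact ht.2.1 (p ++ j :: q) i (by simpa using h) ih

theorem VarLeaf.subtree {F K : Type} {t : PTree F K} (ht : VarLeaf t) (p : Pos) :
    VarLeaf (subtree t p) := by
  intro q k hq j q'
  have := ht (p ++ q) k hq j q'
  simpa [_root_.subtree] using this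

/-- A variable position is the only labelled position among its extensions. -/
theorem VarLeaf.eq_of_prefix {F K : Type} {t : PTree F K} (ht : VarLeaf t) {p q : Pos} {k : K}
    (hp : t p = some (.var k)) (hpq : p <+: q) (hq : t q ≠ none) : q = p := by
  obtain ⟨s, rfl⟩ := hpq
  cases s with
  | nil => simp
  | cons j s => exact absurd (ht p k hp j s) hq

theorem VarLeaf.eq_of_common_prefix {F K : Type} {t : PTree F K} (ht : VarLeaf t)
    {p q q' : Pos} {k k' : K} (hq : t q = some (.var k)) (hq' : t q' = some (.var k'))
    (hqp : q <+: p) (hqp' : q' <+: p) : q = q' := by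
  rcases List.prefix_or_prefix_of_prefix hqp hqp' with h | h
  · exact (ht.eq_of_prefix hq h (by simp [hq'])).symm
  · exact ht.eq_of_prefix hq' h (by simp [hq])

theorem subst_append {F K : Type} {z : K} {t : PTree F K} (ht : VarLeaf t) (u : PTree F K)
    {q : Pos} (hq : t q = some (.var z)) (p : Pos) : subst z t u (q ++ p) = u p := by
  have h : ∃ q' : Pos, q' <+: q ++ p ∧ t q' = some (Label.var z) :=
    ⟨q, List.prefix_append q p, hq⟩
  have he : h.choose = q :=
    ht.eq_of_common_prefix h.choose_spec.2 hq h.choose_spec.1 (List.prefix_append q p)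
  rw [subst, dif_pos h, he, List.drop_left]

theorem subst_of_not_exists {F K : Type} {z : K} {t : PTree F K} (u : PTree F K) {p : Pos}
    (h : ¬ ∃ q : Pos, q <+: p ∧ t q = some (Label.var z)) : subst z t u p = t p := by
  rw [subst, dif_neg h]

theorem subst_of_root_var {F K : Type} {z : K} {t : PTree F K} (ht : VarLeaf t)
    (u : PTree F K) (h : t [] = some (.var z)) : subst z t u = u :=
  funext fun p => subst_append ht u h p

theorem subst_root {F K : Type} {z : K} {t : PTree F K} (u : PTree F K)
    (h : t [] ≠ some (.var z)) : subst z t u [] = t [] := by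
  refine subst_of_not_exists u ?_
  rintro ⟨q, hq, hz⟩
  rw [List.prefix_nil.1 hq] at hz
  exact h hz

theorem subtree_subst {F K : Type} {z : K} {t : PTree F K} (ht : VarLeaf t)
    (u : PTree F K) (h : t [] ≠ some (.var z)) (i : ℕ) :
    subtree (subst z t u) [i] = subst z (subtree t [i]) u := by
  funext p
  change subst z t u (i :: p) = _
  by_cases hp : ∃ q : Pos, q <+: p ∧ subtree t [i] q = some (Label.var z)
  · obtain ⟨q, ⟨s, rfl⟩, hq⟩ := hp
    rw [subst_append (ht.subtree [i]) u hq]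
    exact subst_append ht u (q := i :: q) hq s
  · rw [subst_of_not_exists u hp]
    refine subst_of_not_exists u ?_
    rintro ⟨q, hq, hz⟩
    cases q with
    | nil => exact h hz
    | cons j q =>
      obtain ⟨rfl, hqp⟩ := List.cons_prefix_cons.1 hq
      exact hp ⟨q, hqp, hz⟩

theorem VarLeaf.subst {F K : Type} {z : K} {t u : PTree F K} (ht : VarLeaf t)
    (hu : VarLeaf u) : VarLeaf (subst z t u) := by
  intro p k hp j r
  by_cases h : ∃ q : Pos, q <+: p ∧ t q = some (Label.var z)
  · obtain ⟨q, ⟨s, rfl⟩, hq⟩ := h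
    rw [subst_append ht u hq] at hp
    rw [List.append_assoc, subst_append ht u hq]
    exact hu s k hp j r
  · rw [subst_of_not_exists u h] at hp
    rw [subst_of_not_exists, ht p k hp j r]
    rintro ⟨q, hq, hz⟩
    rcases List.prefix_or_prefix_of_prefix hq (List.prefix_append p (j :: r)) with h' | h'
    · exact h ⟨q, h', hz⟩
    · rw [ht.eq_of_prefix hp h' (by simp [hz])] at hz
      exact h ⟨p, List.prefix_rfl, hz⟩

theorem varLeaf_leafTree {F K : Type} (l : Label F K) : VarLeaf (leafTree l) := by
  intro p k _ j q
  simp [leafTree]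

theorem VarLeaf.node1 {F K : Type} {t : PTree F K} (f : F) (ht : VarLeaf t) :
    VarLeaf (node1 f t) := by
  intro p k hp j q
  match p, hp with
  | [], hp => simp [_root_.node1] at hp
  | 1 :: p, hp => exact ht p k hp j q
  | 0 :: p, hp => simp [_root_.node1] at hp
  | (n + 2) :: p, hp => simp [_root_.node1] at hp

theorem VarLeaf.node2 {F K : Type} {t₁ t₂ : PTree F K} (f : F) (h₁ : VarLeaf t₁)
    (h₂ : VarLeaf t₂) : VarLeaf (node2 f t₁ t₂) := by
  intro p k hp j q
  match p, hp with
  | [], hp => simp [_root_.node2] at hp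
  | 1 :: p, hp => exact h₁ p k hp j q
  | 2 :: p, hp => exact h₂ p k hp j q
  | 0 :: p, hp => simp [_root_.node2] at hp
  | (n + 3) :: p, hp => simp [_root_.node2] at hp

theorem TreeOf.varLeaf {A L K : Type} {E : RegExp A L K} {t : PTree (PSym A L) K}
    (h : TreeOf E t) : VarLeaf t := by
  induction h with
  | eps => exact varLeaf_leafTree _
  | var z => exact varLeaf_leafTree _
  | seq act _ ih => exact ih.node1 _
  | cond φ _ _ ih₁ ih₂ => exact ih₁.node2 _ ih₂
  | prob p _ _ ih₁ ih₂ => exact ih₁.node2 _ ih₂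
  | ndet _ _ ih₁ ih₂ => exact ih₁.node2 _ ih₂
  | concat z _ _ ih₁ ih₂ => exact ih₁.subst ih₂
  | closure z _ hs _ _ _ => exact hs.varLeaf

theorem isTree_loopTree {F K : Type} (ar : F → ℕ) :
    IsTree ar (loopTree : PTree F K) := by
  refine ⟨by simp [loopTree], by simp [loopTree], ?_⟩
  intro p l hp j
  have hl : l = Label.loop := by
    simp only [loopTree] at hp
    split at hp <;> simp_all
  subst hl
  simp only [loopTree, Label.arity]
  simp
  omega

theorem Refine.eq_loopTree {F K : Type} {ar : F → ℕ} {t : PTree F K}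
    (h : Refine ar t loopTree) : t = loopTree := by
  obtain ⟨R, hR, h⟩ := h
  rcases hR _ _ h with h | ⟨l, hl, -, h, -⟩
  · exact h
  · simp only [loopTree, if_true, Option.some.injEq] at h
    exact absurd h.symm hl

/-- A separately Scott-continuous binary operation preserves suprema of pairs of chains. -/
theorem isLUB_range_map₂ {M : Type} [PartialOrder M] {f : M → M → M}
    (hl : ∀ b, ScottContinuous fun x => f x b) (hr : ∀ a, ScottContinuous (f a))
    {a b : ℕ → M} (ha : Monotone a) (hb : Monotone b) {x y : M}
    (hx : IsLUB (Set.range a) x) (hy : IsLUB (Set.range b) y) :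
    IsLUB (Set.range fun i => f (a i) (b i)) (f x y) := by
  have key : ∀ {c : ℕ → M} {w : M} {g : M → M}, ScottContinuous g → Monotone c →
      IsLUB (Set.range c) w → IsLUB (g '' Set.range c) (g w) := fun hg hc hw =>
    hg (Set.range_nonempty _) (directedOn_range.2 hc.directed_le) hw
  constructor
  · rintro _ ⟨i, rfl⟩
    exact ((hl _).monotone (hx.1 ⟨i, rfl⟩)).trans ((hr _).monotone (hy.1 ⟨i, rfl⟩))
  · intro w hw
    refine (key (hl y) ha hx).2 ?_
    rintro _ ⟨_, ⟨i, rfl⟩, rfl⟩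
    refine (key (hr (a i)) hb hy).2 ?_
    rintro _ ⟨_, ⟨j, rfl⟩, rfl⟩
    refine le_trans ?_ (hw ⟨max i j, rfl⟩)
    exact ((hl _).monotone (ha (le_max_left i j))).trans
      ((hr _).monotone (hb (le_max_right i j)))

section MarkovAlg

variable {A L K M : Type} [PartialOrder M] (P : MarkovAlg L M) (ia : A → M)

/-- The operation on the values of the first two subtrees selected by a root label. -/
def labelOp (γ : K → M) : Option (Label (PSym A L) K) → M → M → M
  | some (.sym .eps), _, _ => P.one
  | some (.sym (.seq act)), a, _ => P.mul (ia act) a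
  | some (.sym (.cond φ)), a, b => P.cond φ a b
  | some (.sym (.prob p)), a, b => P.prob p a b
  | some (.sym .ndet), a, b => P.ndet a b
  | some (.var k), _, _ => γ k
  | _, _, _ => P.bot

theorem maSeq_succ (γ : K → M) (i : ℕ) (t : PTree (PSym A L) K) :
    maSeq P ia γ (i + 1) t = labelOp P ia γ (t [])
      (maSeq P ia γ i (subtree t [1])) (maSeq P ia γ i (subtree t [2])) := by
  rw [maSeq]
  rcases t [] with _ | ((_ | _ | _ | _ | _) | _ | _) <;> rfl

theorem labelOp_scott_left (γ : K → M) (l : Option (Label (PSym A L) K)) (b : M) :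
    ScottContinuous fun x => labelOp P ia γ l x b := by
  rcases l with _ | ((_ | _ | _ | _ | _) | _ | _)
  case some.sym.seq act => exact P.mul_scott_right (ia act)
  case some.sym.cond φ => exact P.cond_scott_left φ b
  case some.sym.prob p => exact P.prob_scott_left p b
  case some.sym.ndet => exact P.ndet_scott_left b
  all_goals exact ScottContinuous.const _

theorem labelOp_scott_right (γ : K → M) (l : Option (Label (PSym A L) K)) (a : M) :
    ScottContinuous (labelOp P ia γ l a) := by
  rcases l with _ | ((_ | _ | _ | _ | _) | _ | _)
  case some.sym.cond φ => exact P.cond_scott_right φ a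
  case some.sym.prob p => exact P.prob_scott_right p a
  case some.sym.ndet => exact P.ndet_scott_right a
  all_goals exact ScottContinuous.const _

theorem labelOp_mono (γ : K → M) (l : Option (Label (PSym A L) K)) {a a' b b' : M}
    (ha : a ≤ a') (hb : b ≤ b') : labelOp P ia γ l a b ≤ labelOp P ia γ l a' b' :=
  ((labelOp_scott_left P ia γ l b).monotone ha).trans
    ((labelOp_scott_right P ia γ l a').monotone hb)

theorem labelOp_update [DecidableEq K] (γ : K → M) {z : K} (w : M)
    {l : Option (Label (PSym A L) K)} (h : l ≠ some (.var z)) :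
    labelOp P ia (Function.update γ z w) l = labelOp P ia γ l := by
  funext a b
  rcases l with _ | ((_ | _ | _ | _ | _) | k | _)
  case some.var =>
    have hk : k ≠ z := fun e => h (by rw [e])
    simp [labelOp, Function.update_of_ne hk]
  all_goals rfl

theorem maSeq_mono (γ : K → M) (t : PTree (PSym A L) K) :
    Monotone fun i => maSeq P ia γ i t := by
  refine monotone_nat_of_le_succ fun i => ?_
  induction i generalizing t with
  | zero => exact P.bot_le _
  | succ i ih =>
    rw [maSeq_succ, maSeq_succ]
    exact labelOp_mono P ia γ _ (ih _) (ih _)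

theorem exists_isTreeInterp (γ : K → M) :
    ∃ r : PTree (PSym A L) K → M, IsTreeInterp P ia γ r := by
  choose r hr using fun t : PTree (PSym A L) K =>
    P.dcpo (Set.range fun i => maSeq P ia γ i t) (Set.range_nonempty _)
      (directedOn_range.2 (maSeq_mono P ia γ t).directed_le)
  exact ⟨r, hr⟩

variable {P ia}

theorem IsTreeInterp.le {γ : K → M} {r : PTree (PSym A L) K → M}
    (hr : IsTreeInterp P ia γ r) (i : ℕ) (t : PTree (PSym A L) K) :
    maSeq P ia γ i t ≤ r t :=
  (hr t).1 ⟨i, rfl⟩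

theorem IsTreeInterp.le_of_forall {γ : K → M} {r : PTree (PSym A L) K → M}
    (hr : IsTreeInterp P ia γ r) {t : PTree (PSym A L) K} {w : M}
    (h : ∀ i, maSeq P ia γ i t ≤ w) : r t ≤ w :=
  (hr t).2 (by rintro _ ⟨i, rfl⟩; exact h i)

/-- The tree interpretation satisfies its coinductive defining equations. -/
theorem IsTreeInterp.eq_labelOp {γ : K → M} {r : PTree (PSym A L) K → M}
    (hr : IsTreeInterp P ia γ r) (t : PTree (PSym A L) K) :
    r t = labelOp P ia γ (t []) (r (subtree t [1])) (r (subtree t [2])) := by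
  have h := isLUB_range_map₂ (labelOp_scott_left P ia γ (t [])) (labelOp_scott_right P ia γ (t []))
    (maSeq_mono P ia γ _) (maSeq_mono P ia γ _) (hr (subtree t [1])) (hr (subtree t [2]))
  refine le_antisymm (hr.le_of_forall fun i => ?_) (h.2 ?_)
  · cases i with
    | zero => exact P.bot_le _
    | succ i =>
      rw [maSeq_succ]
      exact h.1 ⟨i, rfl⟩
  · rintro _ ⟨i, rfl⟩
    exact (maSeq_succ P ia γ i t).symm.trans_le (hr.le (i + 1) t)

variable [DecidableEq K]

theorem maSeq_subst_le {γ : K → M} {z : K} {u : PTree (PSym A L) K} {w : M} (i : ℕ)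
    (hw : ∀ j ≤ i, maSeq P ia γ j u ≤ w) {t : PTree (PSym A L) K} (ht : VarLeaf t) :
    maSeq P ia γ i (subst z t u) ≤ maSeq P ia (Function.update γ z w) i t := by
  induction i generalizing t with
  | zero => exact P.bot_le _
  | succ i ih =>
    by_cases h : t [] = some (.var z)
    · rw [subst_of_root_var ht u h, maSeq_succ _ _ (Function.update γ z w), h]
      simpa [labelOp] using hw (i + 1) le_rfl
    · rw [maSeq_succ, maSeq_succ, subst_root u h, labelOp_update P ia γ w h,
        subtree_subst ht u h, subtree_subst ht u h]
      have hw' : ∀ j ≤ i, maSeq P ia γ j u ≤ w := fun j hj => hw j (by omega)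
      exact labelOp_mono P ia γ _ (ih hw' (ht.subtree _)) (ih hw' (ht.subtree _))

/-- With a root other than the substituted variable, one approximation step is gained. -/
theorem maSeq_succ_subst_le {γ : K → M} {z : K} {u : PTree (PSym A L) K} {w : M} (i : ℕ)
    (hw : ∀ j ≤ i, maSeq P ia γ j u ≤ w) {t : PTree (PSym A L) K} (ht : VarLeaf t)
    (h : t [] ≠ some (.var z)) :
    maSeq P ia γ (i + 1) (subst z t u) ≤ maSeq P ia (Function.update γ z w) (i + 1) t := by
  rw [maSeq_succ, maSeq_succ, subst_root u h, labelOp_update P ia γ w h,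
    subtree_subst ht u h, subtree_subst ht u h]
  exact labelOp_mono P ia γ _ (maSeq_subst_le i hw (ht.subtree _))
    (maSeq_subst_le i hw (ht.subtree _))

theorem maSeq_update_le {γ : K → M} {r : PTree (PSym A L) K → M}
    (hr : IsTreeInterp P ia γ r) (z : K) (u : PTree (PSym A L) K) (i : ℕ)
    {t : PTree (PSym A L) K} (ht : VarLeaf t) :
    maSeq P ia (Function.update γ z (r u)) i t ≤ r (subst z t u) := by
  induction i generalizing t with
  | zero => exact P.bot_le _
  | succ i ih =>
    rw [maSeq_succ]
    by_cases h : t [] = some (.var z)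
    · rw [subst_of_root_var ht u h, h]
      simp [labelOp]
    · rw [hr.eq_labelOp (subst z t u), subst_root u h, labelOp_update P ia γ _ h,
        subtree_subst ht u h, subtree_subst ht u h]
      exact labelOp_mono P ia γ _ (ih (ht.subtree _)) (ih (ht.subtree _))

theorem IsTreeInterp.subst {γ : K → M} {z : K} {r r' : PTree (PSym A L) K → M}
    {u : PTree (PSym A L) K} (hr : IsTreeInterp P ia γ r)
    (hr' : IsTreeInterp P ia (Function.update γ z (r u)) r')
    {t : PTree (PSym A L) K} (ht : VarLeaf t) : r (subst z t u) = r' t :=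
  le_antisymm
    (hr.le_of_forall fun i =>
      (maSeq_subst_le i (fun j _ => hr.le j u) ht).trans (hr'.le i t))
    (hr'.le_of_forall fun i => maSeq_update_le hr z u i ht)

/-- The value of the least fixed point of substitution lies below every fixed point of the
interpretation of the body. -/
theorem maSeq_le_of_fixed {γ : K → M} {z : K} {t s : PTree (PSym A L) K} (ht : VarLeaf t)
    (hfix : subst z t s = s)
    (hleast : ∀ u, IsTree PSym.arity u → subst z t u = u → Refine PSym.arity s u)
    {w : M} {r : PTree (PSym A L) K → M}
    (hr : IsTreeInterp P ia (Function.update γ z w) r) (hw : r t = w) (i : ℕ) :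
    maSeq P ia γ i s ≤ w := by
  by_cases h : t [] = some (.var z)
  · have hs : s = loopTree :=
      (hleast loopTree (isTree_loopTree _) (subst_of_root_var ht _ h)).eq_loopTree
    cases i with
    | zero => exact P.bot_le _
    | succ i =>
      rw [maSeq_succ, hs]
      exact P.bot_le _
  · induction i using Nat.strong_induction_on with
    | _ i ih =>
      cases i with
      | zero => exact P.bot_le _
      | succ i =>
        rw [← hfix]
        exact (maSeq_succ_subst_le i (fun j hj => ih j (by omega)) ht h).trans
          ((hr.le (i + 1) t).trans hw.le)

end MarkovAlg

/-- The algebraic interpretation of a regular infinite-tree expression in a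
Markov algebra coincides with the tree interpretation of its hyper-path:
`M_γ⟦E⟧ = r^M_γ(𝓣_K⟦E⟧)`. -/
theorem algInterp_eq_treeInterp {A L K M : Type} [PartialOrder M] [DecidableEq K]
    (P : MarkovAlg L M) (ia : A → M)
    (E : RegExp A L K) (γ : K → M) (v : M) (t : PTree (PSym A L) K)
    (r : PTree (PSym A L) K → M)
    (hv : MInterp P ia E γ v) (htree : TreeOf E t)
    (hr : IsTreeInterp P ia γ r) :
    v = r t := by
  induction hv generalizing t r with
  | eps γ => cases htree; rw [hr.eq_labelOp]; rfl
  | var γ z => cases htree; rw [hr.eq_labelOp]; rfl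
  | seq act _ ih =>
    cases htree with
    | seq _ ht => rw [ih _ _ ht hr, hr.eq_labelOp (node1 _ _)]; rfl
  | cond φ _ _ ih₁ ih₂ =>
    cases htree with
    | cond _ h₁ h₂ => rw [ih₁ _ _ h₁ hr, ih₂ _ _ h₂ hr, hr.eq_labelOp (node2 _ _ _)]; rfl
  | prob p _ _ ih₁ ih₂ =>
    cases htree with
    | prob _ h₁ h₂ => rw [ih₁ _ _ h₁ hr, ih₂ _ _ h₂ hr, hr.eq_labelOp (node2 _ _ _)]; rfl
  | ndet _ _ ih₁ ih₂ =>
    cases htree with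
    | ndet h₁ h₂ => rw [ih₁ _ _ h₁ hr, ih₂ _ _ h₂ hr, hr.eq_labelOp (node2 _ _ _)]; rfl
  | concat z _ _ ih₂ ih₁ =>
    cases htree with
    | concat _ h₁ h₂ =>
      obtain rfl := ih₂ _ _ h₂ hr
      obtain ⟨r', hr'⟩ := exists_isTreeInterp P ia _
      rw [ih₁ _ _ h₁ hr', hr.subst hr' h₁.varLeaf]
  | closure z g _ hfix hleast ih =>
    cases htree with
    | closure _ ht _ hs hsl =>
      apply le_antisymm
      · obtain ⟨r', hr'⟩ := exists_isTreeInterp P ia _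
        refine hleast _ ?_
        rw [ih _ _ _ ht hr', ← hr.subst hr' ht.varLeaf, hs]
      · obtain ⟨r', hr'⟩ := exists_isTreeInterp P ia _
        exact hr.le_of_forall
          (maSeq_le_of_fixed ht.varLeaf hs hsl hr' ((ih _ _ _ ht hr').symm.trans hfix))
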